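/- arXiv:1806.09086 — 4 statements merged into one kernel-verified Lean document; each statement's English description precedes it below -/
import Mathlib

section
/- Let k ≥ 1, let n₀, n₁, …, n_k ≥ 1 be integers with m = n₁ + ⋯ + n_k and n* = n₀ + ⋯ + n_k, and let β₁, …, β_k > 0. Then ∫_{B₁ × ⋯ × B_k} ∏_{i=1}^k (1 - ‖r_i‖²)^{(n* - n_i)/2 - 1} · [∏_{i=1}^k (1 - ‖r_i‖²) + Σ_{i=1}^k β_i^{-1} ‖r_i‖² ∏_{j≠i, 1≤j≤k} (1 - ‖r_j‖²)]^{-n*/2} dr₁ ⋯ dr_k = Γ(n₀/2) π^{m/2} (∏_{i=1}^k β_i^{n_i/2}) / Γ(n*/2), where B_i is the open unit ball of ℝ^{n_i}. Consequently the multivector variate Pearson type II density, obtained from the multivector variate t density by the block-wise change of variables t_i = (1 - ‖r_i‖²)^{-1/2} r_i, integrates to 1 over B₁ × ⋯ × B_k. -/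
open MeasureTheory

lemma aux_pow {w : ℝ} (hw : 0 < w) (y : ℝ) (d : ℕ) (hd : 1 ≤ d) :
    y ^ (d - 1) * w ^ (-((d : ℝ) / 2) - 1) = w ^ (-(3 / 2) : ℝ) * (y / √w) ^ (d - 1) := by
  rw [div_pow, Real.sqrt_eq_rpow, ← Real.rpow_natCast (w ^ (1 / 2 : ℝ)), ← Real.rpow_mul hw.le,
    Nat.cast_sub hd]
  have : w ^ (-((d : ℝ) / 2) - 1) = w ^ (-(3 / 2) : ℝ) / w ^ ((1 / 2 : ℝ) * ((d : ℝ) - (1 : ℕ))) := by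
    rw [← Real.rpow_sub hw]; congr 1; push_cast; ring
  rw [this]; ring

lemma aux_deriv {y : ℝ} (hy : 0 < 1 - y ^ 2) :
    HasDerivAt (fun y : ℝ => y / √(1 - y ^ 2)) ((1 - y ^ 2) ^ (-(3 / 2) : ℝ)) y := by
  have h1 : HasDerivAt (fun y : ℝ => 1 - y ^ 2) (-(2 * y)) y := by
    simpa using ((hasDerivAt_id y).pow 2).const_sub 1
  have h2 := (hasDerivAt_id y).div (h1.sqrt hy.ne') (Real.sqrt_pos.2 hy).ne'
  convert! h2 using 1
  have hs := Real.sqrt_pos.2 hy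
  have hq : √(1 - y ^ 2) ^ 2 = 1 - y ^ 2 := Real.sq_sqrt hy.le
  have : (1 - y ^ 2) ^ (-(3 / 2) : ℝ) = (√(1 - y ^ 2) ^ 3)⁻¹ := by
    rw [Real.rpow_neg hy.le, Real.sqrt_eq_rpow, ← Real.rpow_natCast (_ ^ (1 / 2 : ℝ)), ← Real.rpow_mul hy.le]
    norm_num
  rw [this]
  set q := √(1 - y ^ 2)
  simp only [id]
  field_simp
  rw [hq]; ring

lemma aux_1d (d : ℕ) (hd : 1 ≤ d) (c : ℝ) :
    ∫ y in Set.Ioi (0 : ℝ), y ^ (d - 1) * Real.exp (-c * y ^ 2) =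
    ∫ y in Set.Ioo (0 : ℝ) 1, y ^ (d - 1) * ((1 - y ^ 2) ^ (-((d : ℝ) / 2) - 1) *
      Real.exp (-(c * (y ^ 2 / (1 - y ^ 2))))) := by
  have hpos : ∀ y ∈ Set.Ioo (0 : ℝ) 1, 0 < 1 - y ^ 2 := by
    rintro y ⟨h0, h1⟩; nlinarith
  have himg : (fun y : ℝ => y / √(1 - y ^ 2)) '' Set.Ioo 0 1 = Set.Ioi 0 := by
    ext v
    constructor
    · rintro ⟨y, hy, rfl⟩
      exact div_pos hy.1 (Real.sqrt_pos.2 (hpos y hy))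
    · intro hv
      have hv : 0 < v := hv
      have hp : 0 < 1 + v ^ 2 := by positivity
      have hs := Real.sqrt_pos.2 hp
      have hq : √(1 + v ^ 2) ^ 2 = 1 + v ^ 2 := Real.sq_sqrt hp.le
      refine ⟨v / √(1 + v ^ 2), ⟨by positivity, ?_⟩, ?_⟩
      · rw [div_lt_one hs]
        apply Real.lt_sqrt_of_sq_lt; linarith
      · have : 1 - (v / √(1 + v ^ 2)) ^ 2 = (1 / √(1 + v ^ 2)) ^ 2 := by
          rw [div_pow, div_pow, hq]; field_simp; ring
        simp only [this]
        rw [Real.sqrt_sq (by positivity)]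
        field_simp
  have hinj : Set.InjOn (fun y : ℝ => y / √(1 - y ^ 2)) (Set.Ioo 0 1) := by
    intro y hy z hz h
    have hy' := hpos y hy
    have hz' := hpos z hz
    have h2 : (y / √(1 - y ^ 2)) ^ 2 = (z / √(1 - z ^ 2)) ^ 2 := by
      simp only at h; rw [h]
    rw [div_pow, div_pow, Real.sq_sqrt hy'.le, Real.sq_sqrt hz'.le,
      div_eq_div_iff hy'.ne' hz'.ne'] at h2
    have h3 : y ^ 2 = z ^ 2 := by linarith
    exact (pow_left_inj₀ hy.1.le hz.1.le two_ne_zero).1 h3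
  rw [← himg, integral_image_eq_integral_abs_deriv_smul measurableSet_Ioo
    (fun y hy => (aux_deriv (hpos y hy)).hasDerivWithinAt) hinj]
  refine setIntegral_congr_fun measurableSet_Ioo fun y hy => ?_
  have hy' := hpos y hy
  simp only [smul_eq_mul]
  rw [abs_of_pos (Real.rpow_pos_of_pos hy' _), ← mul_assoc, ← aux_pow hy' y d hd, mul_assoc,
    div_pow, Real.sq_sqrt hy'.le, neg_mul]

lemma aux_ball (d : ℕ) (hd : 1 ≤ d) (c : ℝ) (hc : 0 < c) :
    ∫ r in Metric.ball (0 : EuclideanSpace ℝ (Fin d)) 1,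
      (1 - ‖r‖ ^ 2) ^ (-((d : ℝ) / 2) - 1) * Real.exp (-(c * (‖r‖ ^ 2 / (1 - ‖r‖ ^ 2))))
    = (Real.pi / c) ^ ((d : ℝ) / 2) := by
  haveI : Nonempty (Fin d) := ⟨⟨0, hd⟩⟩
  have key := GaussianFourier.integral_rexp_neg_mul_sq_norm (V := EuclideanSpace ℝ (Fin d)) hc
  rw [finrank_euclideanSpace_fin] at key
  rw [← key, integral_fun_norm_addHaar volume (fun y => Real.exp (-c * y ^ 2)),
    ← integral_indicator Metric.isOpen_ball.measurableSet]
  set g : ℝ → ℝ := fun y => (1 - y ^ 2) ^ (-((d : ℝ) / 2) - 1) *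
    Real.exp (-(c * (y ^ 2 / (1 - y ^ 2)))) with hg
  have h1 : (fun r => (Metric.ball (0 : EuclideanSpace ℝ (Fin d)) 1).indicator
      (fun r => (1 - ‖r‖ ^ 2) ^ (-((d : ℝ) / 2) - 1) *
        Real.exp (-(c * (‖r‖ ^ 2 / (1 - ‖r‖ ^ 2))))) r)
      = fun r => (Set.Iio (1 : ℝ)).indicator g ‖r‖ := by
    funext r
    simp [Set.indicator, hg]
  rw [h1, integral_fun_norm_addHaar volume ((Set.Iio (1 : ℝ)).indicator g),
    finrank_euclideanSpace_fin]
  congr 2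
  simp only [smul_eq_mul]
  rw [aux_1d d hd c]
  have h2 : (fun y : ℝ => y ^ (d - 1) * (Set.Iio (1 : ℝ)).indicator g y) =
      (Set.Iio (1 : ℝ)).indicator (fun y => y ^ (d - 1) * g y) := by
    funext y; by_cases h : y < 1 <;> simp [Set.indicator, h]
  rw [h2, setIntegral_indicator measurableSet_Iio, Set.Ioi_inter_Iio]

lemma aux_main (k : ℕ) (n₀ : ℕ) (hn₀ : 1 ≤ n₀)
    (n : Fin k → ℕ) (hn : ∀ i, 1 ≤ n i) (β : Fin k → ℝ) (hβ : ∀ i, 0 < β i)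
    (m nstar : ℕ) (hm : m = ∑ i, n i) (hns : nstar = n₀ + m) :
    (∫ r : Π i, EuclideanSpace ℝ (Fin (n i)) in
        Set.univ.pi (fun i => Metric.ball (0 : EuclideanSpace ℝ (Fin (n i))) 1),
        (∏ i, (1 - ‖r i‖ ^ 2) ^ (((nstar : ℝ) - n i) / 2 - 1)) *
          ((∏ i, (1 - ‖r i‖ ^ 2)) +
              ∑ i, (β i)⁻¹ * ‖r i‖ ^ 2 * ∏ j ∈ Finset.univ.erase i, (1 - ‖r j‖ ^ 2)) ^
            (-((nstar : ℝ) / 2))) =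
        Real.Gamma ((n₀ : ℝ) / 2) * Real.pi ^ ((m : ℝ) / 2) *
          (∏ i, (β i) ^ ((n i : ℝ) / 2)) / Real.Gamma ((nstar : ℝ) / 2) := by
  have hN : (0 : ℝ) < (nstar : ℝ) / 2 := by
    have : 0 < nstar := by omega
    positivity
  have hn0' : (0 : ℝ) < (n₀ : ℝ) / 2 := by positivity
  have hGN := Real.Gamma_pos_of_pos hN
  set G : ℝ → (i : Fin k) → EuclideanSpace ℝ (Fin (n i)) → ℝ := fun s i r =>
    (1 - ‖r‖ ^ 2) ^ (-((n i : ℝ) / 2) - 1) *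
      Real.exp (-((s * (β i)⁻¹) * (‖r‖ ^ 2 / (1 - ‖r‖ ^ 2)))) with hG
  set F : (Π i, EuclideanSpace ℝ (Fin (n i))) → ℝ → ℝ := fun r s =>
    (∏ i, G s i (r i)) * (s ^ ((nstar : ℝ) / 2 - 1) * Real.exp (-s)) with hF
  set S : Set (Π i, EuclideanSpace ℝ (Fin (n i))) :=
    Set.univ.pi (fun i => Metric.ball (0 : EuclideanSpace ℝ (Fin (n i))) 1) with hS
  have hSm : MeasurableSet S :=
    MeasurableSet.univ_pi fun i => Metric.isOpen_ball.measurableSet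
  set μ : Measure (Π i, EuclideanSpace ℝ (Fin (n i))) := volume.restrict S with hμ
  have hμ' : μ = Measure.pi (fun i => volume.restrict
      (Metric.ball (0 : EuclideanSpace ℝ (Fin (n i))) 1)) := by
    rw [hμ, hS, volume_pi, Measure.restrict_pi_pi]
  have hpos : ∀ r ∈ S, ∀ i, 0 < 1 - ‖r i‖ ^ 2 := by
    intro r hr i
    have : ‖r i‖ < 1 := by simpa using hr i (Set.mem_univ i)
    nlinarith [norm_nonneg (r i)]
  have hGint : ∀ s > 0, ∀ i, ∫ r in Metric.ball (0 : EuclideanSpace ℝ (Fin (n i))) 1, G s i r =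
      (Real.pi / (s * (β i)⁻¹)) ^ ((n i : ℝ) / 2) := fun s hs i =>
    aux_ball (n i) (hn i) _ (mul_pos hs (inv_pos.2 (hβ i)))
  have hGi : ∀ s > 0, ∀ i, Integrable (G s i)
      (volume.restrict (Metric.ball (0 : EuclideanSpace ℝ (Fin (n i))) 1)) := by
    intro s hs i
    apply Integrable.of_integral_ne_zero
    rw [hGint s hs i]
    have := hβ i
    have := Real.pi_pos
    positivity
  set C : ℝ := Real.pi ^ ((m : ℝ) / 2) * ∏ i, (β i) ^ ((n i : ℝ) / 2) with hC
  have hFr : ∀ s > 0, ∫ r, F r s ∂μ = C * (Real.exp (-s) * s ^ ((n₀ : ℝ) / 2 - 1)) := by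
    intro s hs
    simp only [hF]
    rw [integral_mul_const, hμ', integral_fintype_prod_eq_prod]
    simp only [hGint s hs]
    have h1 : ∀ i, (Real.pi / (s * (β i)⁻¹)) ^ ((n i : ℝ) / 2) =
        Real.pi ^ ((n i : ℝ) / 2) * s ^ (-((n i : ℝ) / 2)) * (β i) ^ ((n i : ℝ) / 2) := by
      intro i
      have hb := hβ i
      have : Real.pi / (s * (β i)⁻¹) = Real.pi * s⁻¹ * β i := by field_simp
      rw [this, Real.mul_rpow (by positivity) hb.le, Real.mul_rpow Real.pi_pos.le (by positivity),
        Real.inv_rpow hs.le, Real.rpow_neg hs.le]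
    simp only [h1, Finset.prod_mul_distrib]
    have hsum : ∑ i, ((n i : ℝ) / 2) = (m : ℝ) / 2 := by
      rw [← Finset.sum_div, hm]; push_cast; rfl
    rw [← Real.rpow_sum_of_pos Real.pi_pos, ← Real.rpow_sum_of_pos hs, Finset.sum_neg_distrib,
      hsum, hC]
    have : s ^ ((n₀ : ℝ) / 2 - 1) = s ^ (-((m : ℝ) / 2)) * s ^ ((nstar : ℝ) / 2 - 1) := by
      rw [← Real.rpow_add hs, hns]; congr 1; push_cast; ring
    rw [this]; ring
  have hmeas : Measurable (Function.uncurry F) := by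
    simp only [hF, hG, Function.uncurry_def]
    fun_prop
  have hFint : Integrable (Function.uncurry F) (μ.prod (volume.restrict (Set.Ioi (0 : ℝ)))) := by
    rw [integrable_prod_iff' hmeas.aestronglyMeasurable]
    constructor
    · filter_upwards [self_mem_ae_restrict measurableSet_Ioi] with s hs
      simp only [Function.uncurry, hF]
      apply Integrable.mul_const
      rw [hμ']
      exact Integrable.fintype_prod_dep (hGi s hs)
    · have := (Real.GammaIntegral_convergent hn0').const_mul C
      refine (integrable_congr ?_).1 this
      filter_upwards [self_mem_ae_restrict measurableSet_Ioi] with s hs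
      have hs : 0 < s := hs
      rw [← hFr s hs]
      refine integral_congr_ae ?_
      filter_upwards [self_mem_ae_restrict hSm] with r hr
      have : 0 ≤ F r s := by
        simp only [hF, hG]
        refine mul_nonneg (Finset.prod_nonneg fun i _ => ?_) (by positivity)
        have := hpos r hr i
        positivity
      simp only [Function.uncurry]
      rw [Real.norm_of_nonneg this]
  have hswap := integral_integral_swap hFint
  rw [setIntegral_congr_fun measurableSet_Ioi (fun s hs => hFr s hs), integral_const_mul,
    ← Real.Gamma_eq_integral hn0'] at hswap
  rw [eq_div_iff hGN.ne']
  have : Real.Gamma ((n₀ : ℝ) / 2) * Real.pi ^ ((m : ℝ) / 2) * (∏ i, (β i) ^ ((n i : ℝ) / 2)) =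
    C * Real.Gamma ((n₀ : ℝ) / 2) := by rw [hC]; ring
  rw [this, ← hswap, ← integral_mul_const]
  refine setIntegral_congr_fun hSm fun r hr => ?_
  have hp := hpos r hr
  have hp0 : 0 < ∏ i, (1 - ‖r i‖ ^ 2) := Finset.prod_pos fun i _ => hp i
  set A : ℝ := 1 + ∑ i, (β i)⁻¹ * (‖r i‖ ^ 2 / (1 - ‖r i‖ ^ 2)) with hA
  have hA0 : 0 < A := by
    have : 0 ≤ ∑ i, (β i)⁻¹ * (‖r i‖ ^ 2 / (1 - ‖r i‖ ^ 2)) :=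
      Finset.sum_nonneg fun i _ => by
        have := hp i
        have := hβ i
        positivity
    linarith
  have hbr : (∏ i, (1 - ‖r i‖ ^ 2)) +
      ∑ i, (β i)⁻¹ * ‖r i‖ ^ 2 * ∏ j ∈ Finset.univ.erase i, (1 - ‖r j‖ ^ 2) =
      (∏ i, (1 - ‖r i‖ ^ 2)) * A := by
    rw [hA, mul_add, mul_one, Finset.mul_sum]
    congr 1
    refine Finset.sum_congr rfl fun i _ => ?_
    rw [← Finset.mul_prod_erase Finset.univ (fun i => 1 - ‖r i‖ ^ 2) (Finset.mem_univ i)]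
    have := (hp i).ne'
    field_simp
  rw [hbr, Real.mul_rpow hp0.le hA0.le]
  have hFs : ∀ s, F r s = (∏ i, (1 - ‖r i‖ ^ 2) ^ (-((n i : ℝ) / 2) - 1)) *
      (s ^ ((nstar : ℝ) / 2 - 1) * Real.exp (-(A * s))) := by
    intro s
    simp only [hF, hG]
    rw [Finset.prod_mul_distrib, ← Real.exp_sum]
    have : Real.exp (-(A * s)) = Real.exp (∑ i, -((s * (β i)⁻¹) *
        (‖r i‖ ^ 2 / (1 - ‖r i‖ ^ 2)))) * Real.exp (-s) := by
      rw [← Real.exp_add, Finset.sum_neg_distrib, hA]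
      congr 1
      rw [add_mul, Finset.sum_mul]
      have : ∑ i, (β i)⁻¹ * (‖r i‖ ^ 2 / (1 - ‖r i‖ ^ 2)) * s =
        ∑ i, s * (β i)⁻¹ * (‖r i‖ ^ 2 / (1 - ‖r i‖ ^ 2)) :=
        Finset.sum_congr rfl fun i _ => by ring
      rw [this]; ring
    rw [this]; ring
  simp only [hFs]
  rw [integral_const_mul, Real.integral_rpow_mul_exp_neg_mul_Ioi hN hA0,
    ← Real.finsetProd_rpow _ _ (fun i _ => (hp i).le)]
  have hprod : (∏ i, (1 - ‖r i‖ ^ 2) ^ (-((n i : ℝ) / 2) - 1)) =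
      (∏ i, (1 - ‖r i‖ ^ 2) ^ (((nstar : ℝ) - n i) / 2 - 1)) *
      ∏ i, (1 - ‖r i‖ ^ 2) ^ (-((nstar : ℝ) / 2)) := by
    rw [← Finset.prod_mul_distrib]
    refine Finset.prod_congr rfl fun i _ => ?_
    rw [← Real.rpow_add (hp i)]; congr 1; ring
  rw [hprod, one_div, Real.inv_rpow hA0.le, Real.rpow_neg hA0.le]
  ring

/-- Normalisation of the multivector variate Pearson type II density over the product
of open unit balls, together with the fact that the corresponding density
integrates to 1. -/
theorem stmt10 (k : ℕ) (hk : 1 ≤ k) (n₀ : ℕ) (hn₀ : 1 ≤ n₀)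
    (n : Fin k → ℕ) (hn : ∀ i, 1 ≤ n i) (β : Fin k → ℝ) (hβ : ∀ i, 0 < β i)
    (m nstar : ℕ) (hm : m = ∑ i, n i) (hns : nstar = n₀ + m) :
    (∫ r : Π i, EuclideanSpace ℝ (Fin (n i)) in
        Set.univ.pi (fun i => Metric.ball (0 : EuclideanSpace ℝ (Fin (n i))) 1),
        (∏ i, (1 - ‖r i‖ ^ 2) ^ (((nstar : ℝ) - n i) / 2 - 1)) *
          ((∏ i, (1 - ‖r i‖ ^ 2)) +
              ∑ i, (β i)⁻¹ * ‖r i‖ ^ 2 * ∏ j ∈ Finset.univ.erase i, (1 - ‖r j‖ ^ 2)) ^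
            (-((nstar : ℝ) / 2))) =
        Real.Gamma ((n₀ : ℝ) / 2) * Real.pi ^ ((m : ℝ) / 2) *
          (∏ i, (β i) ^ ((n i : ℝ) / 2)) / Real.Gamma ((nstar : ℝ) / 2) ∧
      (∫ r : Π i, EuclideanSpace ℝ (Fin (n i)) in
          Set.univ.pi (fun i => Metric.ball (0 : EuclideanSpace ℝ (Fin (n i))) 1),
          Real.Gamma ((nstar : ℝ) / 2) * (∏ i, (β i) ^ (-((n i : ℝ) / 2))) /
              (Real.Gamma ((n₀ : ℝ) / 2) * Real.pi ^ ((m : ℝ) / 2)) *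
            ((∏ i, (1 - ‖r i‖ ^ 2) ^ (((nstar : ℝ) - n i) / 2 - 1)) *
              ((∏ i, (1 - ‖r i‖ ^ 2)) +
                  ∑ i, (β i)⁻¹ * ‖r i‖ ^ 2 *
                    ∏ j ∈ Finset.univ.erase i, (1 - ‖r j‖ ^ 2)) ^
                (-((nstar : ℝ) / 2)))) = 1 := by
  have h := aux_main k n₀ hn₀ n hn β hβ m nstar hm hns
  refine ⟨h, ?_⟩
  rw [integral_const_mul, h]
  have hN : (0 : ℝ) < (nstar : ℝ) / 2 := by
    have : 0 < nstar := by omega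
    positivity
  have hn0' : (0 : ℝ) < (n₀ : ℝ) / 2 := by positivity
  have h1 := Real.Gamma_pos_of_pos hN
  have h2 := Real.Gamma_pos_of_pos hn0'
  have h3 := Real.rpow_pos_of_pos Real.pi_pos ((m : ℝ) / 2)
  have h4 : 0 < ∏ i, (β i) ^ ((n i : ℝ) / 2) :=
    Finset.prod_pos fun i _ => Real.rpow_pos_of_pos (hβ i) _
  have h5 : ∏ i, (β i) ^ (-((n i : ℝ) / 2)) = (∏ i, (β i) ^ ((n i : ℝ) / 2))⁻¹ := by
    rw [← Finset.prod_inv_distrib]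
    exact Finset.prod_congr rfl fun i _ => Real.rpow_neg (hβ i).le _
  rw [h5]
  field_simp
end

section
/- Let k ≥ 1, let α₁, …, α_k > 0 and σ₁, …, σ_k > 0 be real numbers with A = α₁ + ⋯ + α_k, and let h : [0, ∞) → [0, ∞] be measurable with ∫₀^∞ z^{A - 1} h(z) dz = Γ(A)/π^{A}. Then ∫_{(0,∞)^k} (π^{A} / ∏_{i=1}^k (σ_i^{2α_i} Γ(α_i))) · h(Σ_{i=1}^k σ_i^{-2} u_i) · ∏_{i=1}^k u_i^{α_i - 1} du = 1; that is, the multivariate generalised gamma density with parameters (α₁,…,α_k; σ₁²,…,σ_k²; h) integrates to 1. -/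
open MeasureTheory
open scoped ENNReal

noncomputable def gd (a x : ℝ) : ℝ≥0∞ :=
  if 0 < x then ENNReal.ofReal (x ^ (a - 1) / Real.Gamma a) else 0

lemma gd_meas (a : ℝ) : Measurable (gd a) := by
  unfold gd
  refine Measurable.ite measurableSet_Ioi ?_ measurable_const
  exact ((measurable_id'.pow_const _).div_const _).ennreal_ofReal

lemma gd_scale (a w t : ℝ) (hw : 0 < w) :
    gd a (w * t) = ENNReal.ofReal (w ^ (a - 1)) * gd a t := by
  unfold gd
  by_cases ht : 0 < t
  · rw [if_pos ht, if_pos (mul_pos hw ht), ← ENNReal.ofReal_mul (by positivity),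
      Real.mul_rpow hw.le ht.le, mul_div_assoc]
  · rw [if_neg ht, if_neg (by rwa [mul_pos_iff_of_pos_left hw]), mul_zero]

lemma li_scale (w : ℝ) (hw : 0 < w) (f : ℝ → ℝ≥0∞) (hf : Measurable f) :
    ∫⁻ x, f x = ENNReal.ofReal w * ∫⁻ t, f (w * t) := by
  conv_lhs => rw [← Real.smul_map_volume_mul_left hw.ne', lintegral_smul_measure,
    lintegral_map hf (by fun_prop), abs_of_pos hw]
  rfl

lemma gd_exp (a : ℝ) (ha : 0 < a) : ∫⁻ x, gd a x * ENNReal.ofReal (Real.exp (-x)) = 1 := by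
  rw [← ProbabilityTheory.lintegral_gammaPDF_eq_one ha one_pos]
  refine lintegral_congr_ae ?_
  filter_upwards [Measure.ae_ne volume (0 : ℝ)] with x hx
  unfold gd
  rcases lt_or_gt_of_ne hx with h | h
  · rw [if_neg h.not_gt, ProbabilityTheory.gammaPDF_of_neg h, zero_mul]
  · have := Real.Gamma_pos_of_pos ha
    rw [if_pos h, ProbabilityTheory.gammaPDF_of_nonneg h.le, ← ENNReal.ofReal_mul (by positivity)]
    congr 1
    rw [Real.one_rpow, one_mul]
    ring

lemma gd_conv0 (a b : ℝ) (ha : 0 < a) (hb : 0 < b) : ∃ C : ℝ≥0∞, ∀ w,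
    ∫⁻ x, gd a x * gd b (w - x) = C * gd (a + b) w := by
  have hG := Real.Gamma_pos_of_pos (add_pos ha hb)
  refine ⟨ENNReal.ofReal (Real.Gamma (a + b)) * ∫⁻ t, gd a t * gd b (1 - t), fun w => ?_⟩
  have ma := gd_meas a
  have mb := gd_meas b
  by_cases hw : 0 < w
  · rw [li_scale w hw _ (by fun_prop)]
    have : ∀ t, gd a (w * t) * gd b (w - w * t) =
        ENNReal.ofReal (w ^ (a - 1) * w ^ (b - 1)) * (gd a t * gd b (1 - t)) := by
      intro t
      rw [show w - w * t = w * (1 - t) by ring, gd_scale _ _ _ hw, gd_scale _ _ _ hw,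
        ENNReal.ofReal_mul (by positivity)]
      ring
    simp_rw [this]
    rw [lintegral_const_mul _ (by fun_prop), ← mul_assoc, ← ENNReal.ofReal_mul hw.le,
      mul_right_comm, gd, if_pos hw, ← ENNReal.ofReal_mul hG.le]
    congr 2
    rw [mul_div_cancel₀ _ hG.ne', ← Real.rpow_add hw]
    nth_rewrite 1 [← Real.rpow_one w]
    rw [← Real.rpow_add hw]
    congr 1
    ring
  · have : ∀ t, gd a t * gd b (w - t) = 0 := by
      intro t
      unfold gd
      by_cases ht : 0 < t
      · rw [if_neg (show ¬ 0 < w - t by linarith), mul_zero]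
      · rw [if_neg ht, zero_mul]
    simp [this]
    right
    rw [gd, if_neg hw]

lemma gd_two0 (a b : ℝ) (ha : 0 < a) (hb : 0 < b) : ∃ C : ℝ≥0∞, ∀ h : ℝ → ℝ≥0∞, Measurable h →
    ∫⁻ x, gd a x * ∫⁻ z, gd b z * h (x + z) = C * ∫⁻ w, gd (a + b) w * h w := by
  obtain ⟨C, hC⟩ := gd_conv0 a b ha hb
  refine ⟨C, fun h hh => ?_⟩
  have ma := gd_meas a
  have mb := gd_meas b
  have mab := gd_meas (a + b)
  have h1 : ∀ x, gd a x * ∫⁻ z, gd b z * h (x + z) = ∫⁻ w, gd a x * gd b (w - x) * h w := by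
    intro x
    rw [← lintegral_add_left_eq_self (fun w => gd a x * gd b (w - x) * h w) x,
      ← lintegral_const_mul _ (by fun_prop)]
    simp [mul_assoc]
  simp_rw [h1]
  rw [lintegral_lintegral_swap (by unfold Function.uncurry; fun_prop), ← lintegral_const_mul _ (by fun_prop)]
  refine lintegral_congr fun w => ?_
  rw [lintegral_mul_const _ (by fun_prop), hC, mul_assoc]

lemma gd_two (a b : ℝ) (ha : 0 < a) (hb : 0 < b) (h : ℝ → ℝ≥0∞) (hh : Measurable h) :
    ∫⁻ x, gd a x * ∫⁻ z, gd b z * h (x + z) = ∫⁻ w, gd (a + b) w * h w := by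
  obtain ⟨C, hC⟩ := gd_two0 a b ha hb
  have ma := gd_meas a
  have mb := gd_meas b
  have h1 := hC (fun x => ENNReal.ofReal (Real.exp (-x))) (by fun_prop)
  rw [gd_exp _ (add_pos ha hb), mul_one] at h1
  have h2 : ∀ x, gd a x * ∫⁻ z, gd b z * ENNReal.ofReal (Real.exp (-(x + z))) =
      gd a x * ENNReal.ofReal (Real.exp (-x)) := by
    intro x
    have : ∀ z, gd b z * ENNReal.ofReal (Real.exp (-(x + z))) = 
      ENNReal.ofReal (Real.exp (-x)) * (gd b z * ENNReal.ofReal (Real.exp (-z))) := by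
      intro z
      rw [neg_add, Real.exp_add, ENNReal.ofReal_mul (by positivity)]
      ring
    simp_rw [this]
    rw [lintegral_const_mul _ (by fun_prop), gd_exp b hb, mul_one]
  simp_rw [h2] at h1
  rw [gd_exp a ha] at h1
  rw [hC h hh, ← h1, one_mul]

lemma gd_comp (a c : ℝ) (hc : 0 < c) (h : ℝ → ℝ≥0∞) (hh : Measurable h) :
    ∫⁻ x, gd a x * h (c * x) = ENNReal.ofReal (c ^ (-a)) * ∫⁻ x, gd a x * h x := by
  have ma := gd_meas a
  rw [li_scale c hc (fun x => gd a x * h x) (by fun_prop)]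
  simp_rw [gd_scale _ _ _ hc, mul_assoc]
  rw [lintegral_const_mul _ (by fun_prop), ← mul_assoc, ← mul_assoc, ← ENNReal.ofReal_mul (by positivity),
    ← ENNReal.ofReal_mul (by positivity)]
  have : c ^ (-a) * c * c ^ (a - 1) = 1 := by
    nth_rewrite 2 [← Real.rpow_one c]
    rw [← Real.rpow_add hc, ← Real.rpow_add hc, show -a + 1 + (a - 1) = 0 by ring, Real.rpow_zero]
  rw [this, ENNReal.ofReal_one, one_mul]

lemma gd_multi (n : ℕ) : ∀ (α c : Fin (n + 1) → ℝ), (∀ i, 0 < α i) → (∀ i, 0 < c i) →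
    ∀ h : ℝ → ℝ≥0∞, Measurable h →
    ∫⁻ u : Fin (n + 1) → ℝ, (∏ i, gd (α i) (u i)) * h (∑ i, c i * u i) =
      (∏ i, ENNReal.ofReal (c i ^ (-α i))) * ∫⁻ z, gd (∑ i, α i) z * h z := by
  induction n with
  | zero =>
    intro α c hα hc h hh
    change ∫⁻ u : Fin 1 → ℝ, (∏ i : Fin 1, gd (α i) (u i)) * h (∑ i : Fin 1, c i * u i) =
      (∏ i : Fin 1, ENNReal.ofReal (c i ^ (-α i))) * ∫⁻ z, gd (∑ i : Fin 1, α i) z * h z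
    simp only [Fin.prod_univ_one, Fin.sum_univ_one]
    have ma := gd_meas (α 0)
    rw [← gd_comp _ _ (hc 0) h hh]
    exact (volume_preserving_funUnique (Fin 1) ℝ).lintegral_comp
      (f := fun x => gd (α 0) x * h (c 0 * x)) (by fun_prop)
  | succ n ih =>
    intro α c hα hc h hh
    have m := fun i => gd_meas (α i)
    have ms := gd_meas (∑ i : Fin (n + 1), α i.succ)
    have e := (volume_preserving_piFinSuccAbove (fun _ : Fin (n + 1 + 1) => ℝ) 0).lintegral_comp
      (f := fun p => (gd (α 0) p.1 * ∏ i : Fin (n + 1), gd (α i.succ) (p.2 i)) *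
        h (c 0 * p.1 + ∑ i : Fin (n + 1), c i.succ * p.2 i)) (by fun_prop)
    have e' : ∫⁻ u : Fin (n + 1 + 1) → ℝ, (∏ i, gd (α i) (u i)) * h (∑ i, c i * u i) = _ :=
      Eq.trans (lintegral_congr fun u => by
        rw [Fin.prod_univ_succ, Fin.sum_univ_succ]; rfl) e
    rw [e', Measure.volume_eq_prod, lintegral_prod _ (by fun_prop)]
    have s : 0 < ∑ i : Fin (n + 1), α i.succ :=
      Finset.sum_pos (fun i _ => hα _) Finset.univ_nonempty
    have key : ∀ x, ∫⁻ y : Fin (n + 1) → ℝ, (gd (α 0) x * ∏ i : Fin (n + 1), gd (α i.succ) (y i)) *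
        h (c 0 * x + ∑ i : Fin (n + 1), c i.succ * y i) =
        (∏ i : Fin (n + 1), ENNReal.ofReal (c i.succ ^ (-α i.succ))) *
        (gd (α 0) x * ∫⁻ z, gd (∑ i : Fin (n + 1), α i.succ) z * h (c 0 * x + z)) := by
      intro x
      simp_rw [mul_assoc]
      rw [lintegral_const_mul _ (by fun_prop),
        ih (fun i => α i.succ) (fun i => c i.succ) (fun i => hα _) (fun i => hc _)
          (fun z => h (c 0 * x + z)) (by fun_prop)]
      ring
    simp only [key]
    have mm : Measurable fun x => ∫⁻ z, gd (∑ i : Fin (n + 1), α i.succ) z * h (x + z) :=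
      Measurable.lintegral_prod_right' (f := fun p : ℝ × ℝ =>
        gd (∑ i : Fin (n + 1), α i.succ) p.2 * h (p.1 + p.2)) (by fun_prop)
    have mp : Measurable fun x => gd (α 0) x *
        ∫⁻ z, gd (∑ i : Fin (n + 1), α i.succ) z * h (c 0 * x + z) :=
      (m 0).mul (mm.comp (by fun_prop : Measurable fun x => c 0 * x))
    rw [lintegral_const_mul _ mp,
      gd_comp _ _ (hc 0) (fun x => ∫⁻ z, gd (∑ i : Fin (n + 1), α i.succ) z * h (x + z)) mm,
      gd_two _ _ (hα 0) s h hh, Fin.prod_univ_succ (n := n + 1), Fin.sum_univ_succ (n := n + 1)]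
    ring

/-- The multivariate generalised gamma density with parameters
`(α₁,…,α_k; σ₁²,…,σ_k²; h)` integrates to 1 over `(0,∞)^k`, whenever the generator
`h` satisfies `∫₀^∞ z^{A-1} h(z) dz = Γ(A)/π^A`, `A = Σ αᵢ`. -/
theorem stmt11 (k : ℕ) (hk : 1 ≤ k) (α σ : Fin k → ℝ) (hα : ∀ i, 0 < α i)
    (hσ : ∀ i, 0 < σ i) (A : ℝ) (hA : A = ∑ i, α i)
    (h : ℝ → ℝ≥0∞) (hh : Measurable h)
    (hnorm : ∫⁻ z in Set.Ioi (0 : ℝ), ENNReal.ofReal (z ^ (A - 1)) * h z =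
      ENNReal.ofReal (Real.Gamma A / Real.pi ^ A)) :
    ∫⁻ u : Fin k → ℝ in Set.univ.pi (fun _ : Fin k => Set.Ioi (0 : ℝ)),
        ENNReal.ofReal (Real.pi ^ A / ∏ i, (σ i ^ (2 * α i) * Real.Gamma (α i))) *
          h (∑ i, ((σ i) ^ 2)⁻¹ * u i) *
          ∏ i, ENNReal.ofReal ((u i) ^ (α i - 1)) = 1 := by
  obtain ⟨n, rfl⟩ : ∃ n, k = n + 1 := ⟨k - 1, by omega⟩
  have hA0 : 0 < A := hA ▸ Finset.sum_pos (fun i _ => hα _) Finset.univ_nonempty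
  have hGA := Real.Gamma_pos_of_pos hA0
  have hG := fun i => Real.Gamma_pos_of_pos (hα i)
  have hpi := Real.rpow_pos_of_pos Real.pi_pos A
  have m := fun i => gd_meas (α i)
  have hP : 0 < ∏ i, σ i ^ (2 * α i) :=
    Finset.prod_pos fun i _ => Real.rpow_pos_of_pos (hσ i) _
  have hQ : 0 < ∏ i, Real.Gamma (α i) := Finset.prod_pos fun i _ => hG i
  have key := gd_multi n α (fun i => ((σ i) ^ 2)⁻¹) hα
    (fun i => inv_pos.2 (pow_pos (hσ i) 2)) h hh
  rw [← hA] at key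
  have hz : ∫⁻ z, gd A z * h z = ENNReal.ofReal (1 / Real.pi ^ A) := by
    have : ∀ z, gd A z * h z = (Set.Ioi (0 : ℝ)).indicator
        (fun z => ENNReal.ofReal (1 / Real.Gamma A) * (ENNReal.ofReal (z ^ (A - 1)) * h z)) z := by
      intro z
      by_cases hz : 0 < z
      · rw [Set.indicator_of_mem (Set.mem_Ioi.2 hz), gd, if_pos hz, ← mul_assoc,
          ← ENNReal.ofReal_mul (by positivity), one_div_mul_eq_div]
      · rw [Set.indicator_of_notMem (by simpa using hz), gd, if_neg hz, zero_mul]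
    simp_rw [this]
    rw [lintegral_indicator measurableSet_Ioi, lintegral_const_mul _ (by fun_prop), hnorm,
      ← ENNReal.ofReal_mul (by positivity)]
    congr 1
    field_simp
  have hc : ∏ i, ENNReal.ofReal ((((σ i) ^ 2)⁻¹) ^ (-α i)) =
      ENNReal.ofReal (∏ i, σ i ^ (2 * α i)) := by
    rw [ENNReal.ofReal_prod_of_nonneg fun i _ => (Real.rpow_pos_of_pos (hσ i) _).le]
    refine Finset.prod_congr rfl fun i _ => ?_
    rw [Real.inv_rpow (by positivity), Real.rpow_neg (by positivity), inv_inv,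
      Real.rpow_mul (hσ i).le, Real.rpow_two]
  have hms : MeasurableSet (Set.univ.pi (fun _ : Fin (n + 1) => Set.Ioi (0 : ℝ))) :=
    MeasurableSet.univ_pi fun _ => measurableSet_Ioi
  rw [← lintegral_indicator hms]
  have hu : ∀ u : Fin (n + 1) → ℝ, (Set.univ.pi (fun _ : Fin (n + 1) => Set.Ioi (0 : ℝ))).indicator
      (fun u => ENNReal.ofReal (Real.pi ^ A / ∏ i, (σ i ^ (2 * α i) * Real.Gamma (α i))) *
          h (∑ i, ((σ i) ^ 2)⁻¹ * u i) * ∏ i, ENNReal.ofReal ((u i) ^ (α i - 1))) u =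
      ENNReal.ofReal (Real.pi ^ A / ∏ i, σ i ^ (2 * α i)) *
        ((∏ i, gd (α i) (u i)) * h (∑ i, ((σ i) ^ 2)⁻¹ * u i)) := by
    intro u
    by_cases hu : ∀ i, 0 < u i
    · rw [Set.indicator_of_mem (by simpa [Set.mem_pi] using hu)]
      have h1 : ∏ i, gd (α i) (u i) = ENNReal.ofReal (1 / ∏ i, Real.Gamma (α i)) *
          ∏ i, ENNReal.ofReal ((u i) ^ (α i - 1)) := by
        have hr := fun i => Real.rpow_nonneg (hu i).le (α i - 1)
        rw [← ENNReal.ofReal_prod_of_nonneg fun i _ => hr i,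
          ← ENNReal.ofReal_mul (by positivity), one_div_mul_eq_div, ← Finset.prod_div_distrib,
          ENNReal.ofReal_prod_of_nonneg fun i _ => div_nonneg (hr i) (hG i).le]
        refine Finset.prod_congr rfl fun i _ => ?_
        rw [gd, if_pos (hu i)]
      rw [h1, Finset.prod_mul_distrib, ← div_div, div_eq_mul_one_div _ (∏ i, Real.Gamma (α i)),
        ENNReal.ofReal_mul (by positivity)]
      ring
    · rw [Set.indicator_of_notMem (by simpa [Set.mem_pi] using hu)]
      push Not at hu
      obtain ⟨i, hi⟩ := hu
      have h0 : ∏ i, gd (α i) (u i) = 0 :=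
        Finset.prod_eq_zero (Finset.mem_univ i) (by rw [gd, if_neg hi.not_gt])
      rw [h0, zero_mul, mul_zero]
  simp_rw [hu]
  rw [lintegral_const_mul _ (by fun_prop), key, hz, hc, ← ENNReal.ofReal_mul hP.le,
    ← ENNReal.ofReal_mul (by positivity), ← ENNReal.ofReal_one]
  congr 1
  field_simp
end

section
/- Let k ≥ 1, let α₀, α₁, …, α_k > 0 and σ₀, σ₁, …, σ_k > 0 be real numbers with α* = α₀ + ⋯ + α_k, and let h : [0, ∞) → [0, ∞] be measurable with ∫₀^∞ z^{α* - 1} h(z) dz = Γ(α*)/π^{α*}. Then ∫_{(0,∞)} ∫_{(0,1)^k} (π^{α*} / ∏_{i=0}^k (σ_i^{2α_i} Γ(α_i))) · s^{α* - 1} · ∏_{i=1}^k (1 - b_i)^{-(α_i + 1)} b_i^{α_i - 1} · h(s σ₀^{-2} (1 + σ₀² Σ_{i=1}^k σ_i^{-2} b_i / (1 - b_i))) db ds = 1; that is, the multivariate generalised gamma–beta type I density with parameters (α₀,…,α_k; σ₀²,…,σ_k²; h), obtained from the generalised gamma–beta type II density by the change of variables f_i = b_i/(1 - b_i), integrates to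 1. -/
open MeasureTheory
open scoped ENNReal

lemma aux_gamma {a r : ℝ} (ha : 0 < a) (hr : 0 < r) :
    ∫⁻ x in Set.Ioi (0:ℝ), ENNReal.ofReal (x ^ (a - 1)) * ENNReal.ofReal (Real.exp (-(r * x)))
      = ENNReal.ofReal ((1 / r) ^ a * Real.Gamma a) := by
  have hpos : 0 < (1 / r) ^ a * Real.Gamma a := by
    have := Real.Gamma_pos_of_pos ha
    positivity
  have hI := Real.integral_rpow_mul_exp_neg_mul_Ioi ha hr
  have hint : IntegrableOn (fun t : ℝ => t ^ (a - 1) * Real.exp (-(r * t))) (Set.Ioi 0) := by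
    by_contra hc
    rw [integral_undef hc] at hI
    exact hpos.ne hI
  rw [← hI, ofReal_integral_eq_lintegral_ofReal hint]
  · refine setLIntegral_congr_fun measurableSet_Ioi fun x hx => ?_
    rw [ENNReal.ofReal_mul (Real.rpow_nonneg (le_of_lt hx) _)]
  · refine (ae_restrict_iff' measurableSet_Ioi).2 (ae_of_all _ fun x hx => ?_)
    have : (0:ℝ) < x := hx
    simp only [Pi.zero_apply]
    positivity

lemma aux_scale {a c : ℝ} (hc : 0 < c) (h : ℝ → ℝ≥0∞) :
    ∫⁻ s in Set.Ioi (0:ℝ), ENNReal.ofReal (s ^ (a - 1)) * h (s * c)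
      = ENNReal.ofReal (c ^ (-a)) *
        ∫⁻ z in Set.Ioi (0:ℝ), ENNReal.ofReal (z ^ (a - 1)) * h z := by
  have himg : (fun s : ℝ => s * c) '' Set.Ioi 0 = Set.Ioi 0 := by
    ext z
    constructor
    · rintro ⟨s, hs, rfl⟩
      exact mul_pos hs hc
    · intro hz
      exact ⟨z / c, div_pos hz hc, by simp [hc.ne']⟩
  have key := lintegral_image_eq_lintegral_abs_deriv_mul (s := Set.Ioi (0:ℝ))
    (f := fun s : ℝ => s * c) (f' := fun _ => c) measurableSet_Ioi
    (fun x _ => by simpa using ((hasDerivAt_id x).mul_const c).hasDerivWithinAt)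
    (fun x _ y _ hxy => by simpa [hc.ne'] using hxy)
    (fun z => ENNReal.ofReal (z ^ (a - 1)) * h z)
  rw [himg] at key
  rw [key, ← lintegral_const_mul' _ _ ENNReal.ofReal_ne_top]
  refine setLIntegral_congr_fun measurableSet_Ioi fun s hs => ?_
  have hs : (0:ℝ) < s := hs
  rw [← mul_assoc, ← mul_assoc, ← ENNReal.ofReal_mul (by positivity),
    ← ENNReal.ofReal_mul (by positivity), abs_of_pos hc, Real.mul_rpow hs.le hc.le]
  congr 2
  have : c ^ (-a) * c * c ^ (a - 1) = 1 := by
    nth_rewrite 2 [← Real.rpow_one c]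
    rw [← Real.rpow_add hc, ← Real.rpow_add hc]
    ring_nf
    simp
  calc s ^ (a-1) = (c ^ (-a) * c * c ^ (a - 1)) * s ^ (a-1) := by rw [this, one_mul]
    _ = _ := by ring

lemma aux_cov {a r : ℝ} (ha : 0 < a) (hr : 0 < r) :
    ∫⁻ b in Set.Ioo (0:ℝ) 1, ENNReal.ofReal ((1 - b) ^ (-(a + 1)) * b ^ (a - 1)) *
      ENNReal.ofReal (Real.exp (-(r * (b / (1 - b)))))
      = ENNReal.ofReal ((1 / r) ^ a * Real.Gamma a) := by
  rw [← aux_gamma ha hr]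
  have himg : (fun b : ℝ => b / (1 - b)) '' Set.Ioo 0 1 = Set.Ioi 0 := by
    ext z
    constructor
    · rintro ⟨s, hs, rfl⟩
      exact div_pos hs.1 (by linarith [hs.2])
    · intro hz
      have hz : 0 < z := hz
      refine ⟨z / (1 + z), ⟨by positivity, by rw [div_lt_one (by positivity)]; linarith⟩, ?_⟩
      simp only
      have : 1 - z / (1 + z) = 1 / (1 + z) := by field_simp; ring
      rw [this]; field_simp
  have key := lintegral_image_eq_lintegral_abs_deriv_mul (s := Set.Ioo (0:ℝ) 1)
    (f := fun b : ℝ => b / (1 - b)) (f' := fun b => ((1 - b) ^ 2)⁻¹) measurableSet_Ioo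
    (fun x hx => by
      have h1 : (1 - x) ≠ 0 := by linarith [hx.2]
      have := ((hasDerivAt_id x).div ((hasDerivAt_id x).const_sub 1) h1).hasDerivWithinAt
        (s := Set.Ioo (0:ℝ) 1)
      convert! this using 1
      simp only [id]
      field_simp
      ring)
    (fun x hx y hy hxy => by
      have h1 : (1 - x) ≠ 0 := by linarith [hx.2]
      have h2 : (1 - y) ≠ 0 := by linarith [hy.2]
      simp only at hxy
      rw [div_eq_div_iff h1 h2] at hxy
      linarith)
    (fun z => ENNReal.ofReal (z ^ (a - 1)) * ENNReal.ofReal (Real.exp (-(r * z))))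
  rw [himg] at key
  rw [key]
  refine setLIntegral_congr_fun measurableSet_Ioo fun b hb => ?_
  have hb0 : 0 < b := hb.1
  have hb1 : 0 < 1 - b := by linarith [hb.2]
  rw [← mul_assoc, ← ENNReal.ofReal_mul (p := |((1 - b) ^ 2)⁻¹|) (by positivity),
    abs_of_pos (by positivity),
    Real.div_rpow hb0.le hb1.le]
  congr 2
  rw [Real.rpow_neg hb1.le, show a + 1 = (a - 1) + (2:ℕ) by push_cast; ring,
    Real.rpow_add_natCast hb1.ne']
  have := (Real.rpow_pos_of_pos hb1 (a-1)).ne'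
  field_simp

lemma aux_prod {n : ℕ} (μ : Fin n → Measure ℝ) [∀ i, SigmaFinite (μ i)]
    (f : Fin n → ℝ → ℝ≥0∞) (hf : ∀ i, Measurable (f i)) :
    ∫⁻ x : Fin n → ℝ, ∏ i, f i (x i) ∂(Measure.pi μ) = ∏ i, ∫⁻ x, f i x ∂(μ i) := by
  induction n with
  | zero => simp
  | succ n ih =>
    rw [← ((measurePreserving_piFinSuccAbove μ 0).symm).lintegral_comp_emb
      (MeasurableEquiv.measurableEmbedding _)]
    simp_rw [MeasurableEquiv.piFinSuccAbove_symm_apply, Fin.insertNthEquiv,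
      Fin.prod_univ_succ, Fin.insertNth_zero]
    simp only [Fin.zero_succAbove, Equiv.coe_fn_mk, Fin.cons_zero, Fin.cons_succ]
    rw [← ih (fun i => μ i.succ) (fun i => f i.succ) (fun i => hf _)]
    refine lintegral_prod_mul (μ := μ 0) (ν := Measure.pi fun i : Fin n => μ i.succ)
      (f := f 0) (g := fun x => ∏ i, f (Fin.succ i) (x i)) (hf 0).aemeasurable ?_
    exact (Finset.measurable_prod _ fun i _ => (hf _).comp (measurable_pi_apply i)).aemeasurable

lemma aux_swap {X : Type*} [MeasurableSpace X] (ν : Measure X) [SFinite ν]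
    (W : X → ℝ≥0∞) (hW : Measurable W) (c : X → ℝ) (hc : Measurable c)
    (hcpos : ∀ᵐ b ∂ν, 0 < c b) (A : ℝ) (h : ℝ → ℝ≥0∞) (hh : Measurable h) :
    ∫⁻ s in Set.Ioi (0:ℝ), ∫⁻ b, ENNReal.ofReal (s ^ (A - 1)) * W b * h (s * c b) ∂ν
      = (∫⁻ b, W b * ENNReal.ofReal (c b ^ (-A)) ∂ν) *
        ∫⁻ z in Set.Ioi (0:ℝ), ENNReal.ofReal (z ^ (A - 1)) * h z := by
  rw [lintegral_lintegral_swap (by fun_prop), ← lintegral_mul_const _ (by fun_prop)]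
  refine lintegral_congr_ae (hcpos.mono fun b hb => ?_)
  simp only
  rw [mul_assoc, ← aux_scale hb, ← lintegral_const_mul _ (by fun_prop)]
  refine lintegral_congr fun s => ?_
  ring

lemma aux_K (k : ℕ) (α₀ σ₀ : ℝ) (hα₀ : 0 < α₀) (hσ₀ : 0 < σ₀)
    (α σ : Fin k → ℝ) (hα : ∀ i, 0 < α i) (hσ : ∀ i, 0 < σ i)
    (αstar : ℝ) (hs : αstar = α₀ + ∑ i, α i) :
    ∫⁻ s in Set.Ioi (0 : ℝ),
      ∫⁻ b : Fin k → ℝ in Set.univ.pi (fun _ : Fin k => Set.Ioo (0 : ℝ) 1),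
          ENNReal.ofReal (s ^ (αstar - 1)) *
          (∏ i, ENNReal.ofReal ((1 - b i) ^ (-(α i + 1)) * (b i) ^ (α i - 1))) *
          ENNReal.ofReal (Real.exp (-(s * ((σ₀ ^ 2)⁻¹ *
            (1 + σ₀ ^ 2 * ∑ i, ((σ i) ^ 2)⁻¹ * (b i / (1 - b i)))))))
     = ENNReal.ofReal (σ₀ ^ (2 * α₀) * Real.Gamma α₀ *
              ∏ i, (σ i ^ (2 * α i) * Real.Gamma (α i))) := by
  have hGi : ∀ i, 0 < σ i ^ (2 * α i) * Real.Gamma (α i) := fun i =>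
    mul_pos (Real.rpow_pos_of_pos (hσ i) _) (Real.Gamma_pos_of_pos (hα i))
  have hsq : ∀ {x : ℝ} (a : ℝ), 0 < x → (1 / (x ^ 2)⁻¹) ^ a = x ^ (2 * a) := by
    intro x a hx
    rw [one_div, inv_inv, Real.rpow_mul hx.le]
    norm_num
  have inner : ∀ s ∈ Set.Ioi (0:ℝ),
      ∫⁻ b : Fin k → ℝ in Set.univ.pi (fun _ : Fin k => Set.Ioo (0 : ℝ) 1),
          ENNReal.ofReal (s ^ (αstar - 1)) *
          (∏ i, ENNReal.ofReal ((1 - b i) ^ (-(α i + 1)) * (b i) ^ (α i - 1))) *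
          ENNReal.ofReal (Real.exp (-(s * ((σ₀ ^ 2)⁻¹ *
            (1 + σ₀ ^ 2 * ∑ i, ((σ i) ^ 2)⁻¹ * (b i / (1 - b i)))))))
      = ENNReal.ofReal (∏ i, (σ i ^ (2 * α i) * Real.Gamma (α i))) *
        (ENNReal.ofReal (s ^ (α₀ - 1)) * ENNReal.ofReal (Real.exp (-((σ₀ ^ 2)⁻¹ * s)))) := by
    intro s hs0
    have hs0 : 0 < s := hs0
    have h1 : ∀ b : Fin k → ℝ, ENNReal.ofReal (s ^ (αstar - 1)) *
          (∏ i, ENNReal.ofReal ((1 - b i) ^ (-(α i + 1)) * (b i) ^ (α i - 1))) *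
          ENNReal.ofReal (Real.exp (-(s * ((σ₀ ^ 2)⁻¹ *
            (1 + σ₀ ^ 2 * ∑ i, ((σ i) ^ 2)⁻¹ * (b i / (1 - b i)))))))
        = (ENNReal.ofReal (s ^ (αstar - 1)) * ENNReal.ofReal (Real.exp (-((σ₀ ^ 2)⁻¹ * s)))) *
          ∏ i, (ENNReal.ofReal ((1 - b i) ^ (-(α i + 1)) * (b i) ^ (α i - 1)) *
            ENNReal.ofReal (Real.exp (-((s * (σ i ^ 2)⁻¹) * (b i / (1 - b i)))))) := by
      intro b
      have : Real.exp (-(s * ((σ₀ ^ 2)⁻¹ *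
            (1 + σ₀ ^ 2 * ∑ i, ((σ i) ^ 2)⁻¹ * (b i / (1 - b i))))))
          = Real.exp (-((σ₀ ^ 2)⁻¹ * s)) *
            ∏ i, Real.exp (-((s * (σ i ^ 2)⁻¹) * (b i / (1 - b i)))) := by
        rw [← Real.exp_sum, ← Real.exp_add, Finset.sum_neg_distrib]
        simp_rw [mul_assoc s]
        rw [← Finset.mul_sum]
        congr 1
        field_simp
        ring
      rw [this, ENNReal.ofReal_mul (Real.exp_pos _).le,
        ENNReal.ofReal_prod_of_nonneg (fun i _ => (Real.exp_pos _).le), Finset.prod_mul_distrib]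
      ring
    simp_rw [h1]
    rw [lintegral_const_mul' _ _ (ENNReal.mul_ne_top ENNReal.ofReal_ne_top ENNReal.ofReal_ne_top),
      volume_pi, Measure.restrict_pi_pi,
      aux_prod (fun _ : Fin k => (volume : Measure ℝ).restrict (Set.Ioo 0 1))
        (fun i x => ENNReal.ofReal ((1 - x) ^ (-(α i + 1)) * x ^ (α i - 1)) *
            ENNReal.ofReal (Real.exp (-((s * (σ i ^ 2)⁻¹) * (x / (1 - x))))))
        (fun i => by fun_prop)]
    have h2 : ∀ i, ∫⁻ x in Set.Ioo (0:ℝ) 1,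
        ENNReal.ofReal ((1 - x) ^ (-(α i + 1)) * x ^ (α i - 1)) *
            ENNReal.ofReal (Real.exp (-((s * (σ i ^ 2)⁻¹) * (x / (1 - x)))))
        = ENNReal.ofReal (s ^ (-α i) * (σ i ^ (2 * α i) * Real.Gamma (α i))) := by
      intro i
      have hi := hσ i
      rw [aux_cov (hα i) (by positivity), ← hsq _ hi, ← mul_assoc, Real.rpow_neg hs0.le,
        ← Real.inv_rpow hs0.le, ← Real.mul_rpow (by positivity) (by positivity)]
      congr 3
      field_simp
    simp_rw [h2]
    rw [← ENNReal.ofReal_prod_of_nonneg (fun i _ => by have := (hGi i).le; positivity),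
      Finset.prod_mul_distrib, ← Real.rpow_sum_of_pos hs0, ENNReal.ofReal_mul (by positivity),
      show α₀ - 1 = (αstar - 1) + ∑ i, -α i by rw [hs, Finset.sum_neg_distrib]; ring,
      Real.rpow_add hs0, ENNReal.ofReal_mul (by positivity)]
    ring
  rw [setLIntegral_congr_fun measurableSet_Ioi inner,
    lintegral_const_mul' _ _ ENNReal.ofReal_ne_top, aux_gamma hα₀ (by positivity), hsq _ hσ₀,
    ← ENNReal.ofReal_mul (Finset.prod_nonneg fun i _ => (hGi i).le), mul_comm]

/-- The multivariate generalised gamma–beta type I density with parameters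
`(α₀,…,α_k; σ₀²,…,σ_k²; h)` integrates to 1 over `(0,∞) × (0,1)^k`, whenever the
generator `h` satisfies `∫₀^∞ z^{α*-1} h(z) dz = Γ(α*)/π^{α*}`, `α* = α₀ + Σ αᵢ`. -/
theorem stmt16 (k : ℕ) (hk : 1 ≤ k) (α₀ σ₀ : ℝ) (hα₀ : 0 < α₀) (hσ₀ : 0 < σ₀)
    (α σ : Fin k → ℝ) (hα : ∀ i, 0 < α i) (hσ : ∀ i, 0 < σ i)
    (αstar : ℝ) (hs : αstar = α₀ + ∑ i, α i)
    (h : ℝ → ℝ≥0∞) (hh : Measurable h)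
    (hnorm : ∫⁻ z in Set.Ioi (0 : ℝ), ENNReal.ofReal (z ^ (αstar - 1)) * h z =
      ENNReal.ofReal (Real.Gamma αstar / Real.pi ^ αstar)) :
    ∫⁻ s in Set.Ioi (0 : ℝ),
      ∫⁻ b : Fin k → ℝ in Set.univ.pi (fun _ : Fin k => Set.Ioo (0 : ℝ) 1),
        ENNReal.ofReal (Real.pi ^ αstar /
            (σ₀ ^ (2 * α₀) * Real.Gamma α₀ *
              ∏ i, (σ i ^ (2 * α i) * Real.Gamma (α i)))) *
          ENNReal.ofReal (s ^ (αstar - 1)) *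
          (∏ i, ENNReal.ofReal ((1 - b i) ^ (-(α i + 1)) * (b i) ^ (α i - 1))) *
          h (s * (σ₀ ^ 2)⁻¹ *
            (1 + σ₀ ^ 2 * ∑ i, ((σ i) ^ 2)⁻¹ * (b i / (1 - b i)))) = 1 := by
  set B : Set (Fin k → ℝ) := Set.univ.pi (fun _ : Fin k => Set.Ioo (0 : ℝ) 1) with hB
  have hBm : MeasurableSet B := MeasurableSet.univ_pi fun _ => measurableSet_Ioo
  have hA : 0 < αstar := by
    rw [hs]
    have := Finset.sum_nonneg (s := Finset.univ) fun i _ => (hα i).le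
    linarith
  have hG := Real.Gamma_pos_of_pos hA
  have hP : 0 < σ₀ ^ (2 * α₀) * Real.Gamma α₀ *
              ∏ i, (σ i ^ (2 * α i) * Real.Gamma (α i)) :=
    mul_pos (mul_pos (Real.rpow_pos_of_pos hσ₀ _) (Real.Gamma_pos_of_pos hα₀))
      (Finset.prod_pos fun i _ =>
        mul_pos (Real.rpow_pos_of_pos (hσ i) _) (Real.Gamma_pos_of_pos (hα i)))
  have hK := aux_K k α₀ σ₀ hα₀ hσ₀ α σ hα hσ αstar hs
  set P := σ₀ ^ (2 * α₀) * Real.Gamma α₀ * ∏ i, (σ i ^ (2 * α i) * Real.Gamma (α i))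
  have hsw := aux_swap ((volume : Measure (Fin k → ℝ)).restrict B)
    (fun b => ∏ i, ENNReal.ofReal ((1 - b i) ^ (-(α i + 1)) * (b i) ^ (α i - 1)))
    (by fun_prop)
    (fun b => (σ₀ ^ 2)⁻¹ * (1 + σ₀ ^ 2 * ∑ i, ((σ i) ^ 2)⁻¹ * (b i / (1 - b i))))
    (by fun_prop)
    ((ae_restrict_iff' hBm).2 (ae_of_all _ fun b hb => by
      have : 0 ≤ ∑ i, ((σ i) ^ 2)⁻¹ * (b i / (1 - b i)) := by
        refine Finset.sum_nonneg fun i _ => ?_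
        have h1 := hb i (Set.mem_univ i)
        exact mul_nonneg (by positivity) (div_nonneg h1.1.le (by linarith [h1.2]))
      positivity)) αstar
  have h1 := hsw (fun z => ENNReal.ofReal (Real.exp (-z))) (by fun_prop)
  have h2 := hsw h hh
  have hg := aux_gamma hA one_pos
  simp only [one_mul, div_one, Real.one_rpow] at hg
  rw [hK, hg] at h1
  rw [hnorm, div_eq_mul_inv, ENNReal.ofReal_mul hG.le, ← mul_assoc, ← h1] at h2
  simp_rw [mul_assoc (ENNReal.ofReal (Real.pi ^ αstar / P)), mul_assoc _ ((σ₀ ^ 2)⁻¹)]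
  simp_rw [lintegral_const_mul' _ _ ENNReal.ofReal_ne_top]
  rw [h2, ← ENNReal.ofReal_mul hP.le, ← ENNReal.ofReal_mul (by positivity),
    ← ENNReal.ofReal_one]
  congr 1
  have : Real.pi ^ αstar ≠ 0 := (Real.rpow_pos_of_pos Real.pi_pos _).ne'
  field_simp
end

section
/- Let k₁, k₂ ≥ 0 with k₁ + k₂ ≥ 1, let α₁, …, α_{k₁} > 0, ρ₁, …, ρ_{k₂} > 0, σ₁, …, σ_{k₁} > 0 and δ₁, …, δ_{k₂} > 0 be real numbers, set A = Σ_{i=1}^{k₁} α_i + Σ_{j=1}^{k₂} ρ_j, and let h : [0, ∞) → [0, ∞] be measurable with ∫₀^∞ z^{A - 1} h(z) dz = Γ(A)/π^{A}. Then ∫_{(0,∞)^{k₁}} ∫_{ℝ^{k₂}} (π^{A} / (∏_{i=1}^{k₁} σ_i^{2α_i} Γ(α_i) · ∏_{j=1}^{k₂} δ_j^{2ρ_j} Γ(ρ_j))) · exp(Σ_{j=1}^{k₂} ρ_j y_j) · ∏_{i=1}^{k₁} u_i^{α_i - 1} · h(Σ_{i=1}^{k₁} σ_i^{-2} u_i +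 Σ_{j=1}^{k₂} δ_j^{-2} e^{y_j}) dy du = 1; that is, the multivariate generalised gamma–log gamma density integrates to 1. -/
open MeasureTheory
open scoped ENNReal

noncomputable def gdens (a z : ℝ) : ℝ≥0∞ :=
  if 0 < z then ENNReal.ofReal (z ^ (a - 1) / Real.Gamma a) else 0

lemma gdens_meas (a : ℝ) : Measurable (gdens a) :=
  Measurable.ite measurableSet_Ioi (by fun_prop) (by fun_prop)

lemma lint_scale (z : ℝ) (hz : 0 < z) (f : ℝ → ℝ≥0∞) (hf : Measurable f) :
    ∫⁻ x, f x = ENNReal.ofReal z * ∫⁻ t, f (z * t) := by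
  conv_lhs => rw [← Real.smul_map_volume_mul_left hz.ne']
  rw [lintegral_smul_measure, lintegral_map hf (by fun_prop), abs_of_pos hz, smul_eq_mul]

lemma gdens_scale (a b z t : ℝ) (ha : 0 < a) (hb : 0 < b) (hz : 0 < z) :
    ENNReal.ofReal z * (gdens a (z * t) * gdens b (z - z * t)) =
      gdens (a + b) z * ProbabilityTheory.betaPDF a b t := by
  by_cases ht : 0 < t ∧ t < 1
  · obtain ⟨h0, h1⟩ := ht
    have h2 : 0 < 1 - t := by linarith
    have e : z - z * t = z * (1 - t) := by ring
    rw [ProbabilityTheory.betaPDF_of_pos_lt_one h0 h1, e, gdens, gdens, gdens,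
      if_pos (mul_pos hz h0), if_pos (mul_pos hz h2), if_pos hz]
    have := Real.Gamma_pos_of_pos ha
    have := Real.Gamma_pos_of_pos hb
    have := Real.Gamma_pos_of_pos (add_pos ha hb)
    rw [← ENNReal.ofReal_mul (by positivity), ← ENNReal.ofReal_mul (by positivity),
      ← ENNReal.ofReal_mul (by positivity), ProbabilityTheory.beta,
      Real.mul_rpow hz.le h0.le, Real.mul_rpow hz.le h2.le,
      show a + b - 1 = 1 + (a - 1) + (b - 1) by ring, Real.rpow_add hz, Real.rpow_add hz,
      Real.rpow_one]
    congr 1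
    field_simp
  · have : gdens a (z * t) * gdens b (z - z * t) = 0 := by
      rcases not_and_or.1 ht with h | h
      · rw [gdens, if_neg, zero_mul]
        rw [mul_pos_iff_of_pos_left hz]; exact h
      · rw [mul_comm, gdens, if_neg, zero_mul]
        nlinarith
    rw [this, mul_zero, ProbabilityTheory.betaPDF_eq, if_neg ht]
    simp

lemma gdens_conv (a b z : ℝ) (ha : 0 < a) (hb : 0 < b) :
    ∫⁻ x, gdens a x * gdens b (z - x) = gdens (a + b) z := by
  have ma := gdens_meas a
  have mb := gdens_meas b
  by_cases hz : 0 < z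
  · rw [lint_scale z hz _ (by fun_prop), ← lintegral_const_mul _ (by fun_prop)]
    simp_rw [gdens_scale a b z _ ha hb hz]
    rw [lintegral_const_mul _
      (by exact (ProbabilityTheory.measurable_betaPDFReal a b).ennreal_ofReal),
      ProbabilityTheory.lintegral_betaPDF_eq_one ha hb, mul_one]
  · have : ∀ x, gdens a x * gdens b (z - x) = 0 := by
      intro x
      by_cases hx : 0 < x
      · rw [mul_comm, gdens, if_neg (by linarith), zero_mul]
      · rw [gdens, if_neg hx, zero_mul]
    simp_rw [this]
    rw [gdens, if_neg hz]; simp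

open Classical in
noncomputable def Jop (a : ℝ) (F : ℝ → ℝ≥0∞) : ℝ≥0∞ :=
  if a = 0 then F 0 else ∫⁻ z, gdens a z * F z

lemma Jop_meas (a : ℝ) (F : ℝ → ℝ≥0∞) (hF : Measurable F) :
    Measurable (fun x => Jop a (fun z => F (x + z))) := by
  unfold Jop
  split_ifs
  · fun_prop
  · have ma := gdens_meas a
    apply Measurable.lintegral_prod_right
    fun_prop

lemma Jop_conv (a b : ℝ) (ha : 0 ≤ a) (hb : 0 ≤ b) (F : ℝ → ℝ≥0∞) (hF : Measurable F) :
    Jop a (fun x => Jop b (fun z => F (x + z))) = Jop (a + b) F := by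
  rcases ha.eq_or_lt with rfl | ha'
  · simp [Jop]
  rcases hb.eq_or_lt with rfl | hb'
  · simp [Jop]
  have ma := gdens_meas a
  have mb := gdens_meas b
  rw [Jop, if_neg ha'.ne', Jop, if_neg (by positivity)]
  simp_rw [Jop, if_neg hb'.ne', ← gdens_conv a b _ ha' hb']
  have e : ∀ x, gdens a x * ∫⁻ z, gdens b z * F (x + z)
      = ∫⁻ z, gdens a x * gdens b (z - x) * F z := by
    intro x
    rw [← lintegral_add_right_eq_self (fun z => gdens a x * gdens b (z - x) * F z) x,
      ← lintegral_const_mul _ (by fun_prop)]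
    congr 1; ext z
    rw [add_sub_cancel_right, add_comm z x, mul_assoc]
  simp_rw [e]
  rw [lintegral_lintegral_swap (by fun_prop)]
  congr 1; ext z
  rw [lintegral_mul_const _ (by fun_prop)]

lemma multi (ν : Measure ℝ) [SigmaFinite ν] (n : ℕ) (a : Fin n → ℝ) (ha : ∀ i, 0 ≤ a i)
    (w : Fin n → ℝ → ℝ≥0∞) (hw : ∀ i, Measurable (w i))
    (φ : Fin n → ℝ → ℝ) (hφ : ∀ i, Measurable (φ i)) (K : Fin n → ℝ≥0∞)
    (H : ∀ i, ∀ F : ℝ → ℝ≥0∞, Measurable F → ∫⁻ u, w i u * F (φ i u) ∂ν = K i * Jop (a i) F)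
    (F : ℝ → ℝ≥0∞) (hF : Measurable F) :
    ∫⁻ u, (∏ i, w i (u i)) * F (∑ i, φ i (u i)) ∂(Measure.pi fun _ : Fin n => ν)
      = (∏ i, K i) * Jop (∑ i, a i) F := by
  induction n generalizing F with
  | zero => simp [Jop]
  | succ n ih =>
    have mp := (measurePreserving_piFinSuccAbove (fun _ : Fin (n+1) => ν) 0).symm
    have hw0 := hw 0
    have hφ0 := hφ 0
    have hws : ∀ i : Fin n, Measurable (w i.succ) := fun i => hw _
    have hφs : ∀ i : Fin n, Measurable (φ i.succ) := fun i => hφ _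
    rw [← mp.lintegral_comp (by fun_prop)]
    rw [lintegral_prod _ (by
      apply Measurable.aemeasurable
      fun_prop)]
    simp only [MeasurableEquiv.piFinSuccAbove_symm_apply, Fin.insertNthEquiv_zero,
      Fin.prod_univ_succ, Fin.sum_univ_succ, Fin.consEquiv_apply, Fin.cons_zero, Fin.cons_succ]
    have key : ∀ x, ∫⁻ y, (w 0 x * ∏ i : Fin n, w i.succ (y i)) *
        F (φ 0 x + ∑ i : Fin n, φ i.succ (y i)) ∂(Measure.pi fun _ : Fin n => ν)
        = (∏ i : Fin n, K i.succ) *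
          (w 0 x * Jop (∑ i : Fin n, a i.succ) (fun z => F (φ 0 x + z))) := by
      intro x
      have := ih (fun i => a i.succ) (fun i => ha _) (fun i => w i.succ) hws
        (fun i => φ i.succ) hφs (fun i => K i.succ) (fun i => H i.succ)
        (fun z => F (φ 0 x + z)) (by fun_prop)
      simp_rw [mul_assoc]
      rw [lintegral_const_mul _ (by fun_prop), this]
      ring
    have mJ := Jop_meas (∑ i : Fin n, a i.succ) F hF
    refine (lintegral_congr key).trans ?_
    rw [lintegral_const_mul _ (by exact hw0.mul (mJ.comp hφ0)), H 0 _ mJ,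
      Jop_conv _ _ (ha 0) (Finset.sum_nonneg fun i _ => ha _) F hF]
    ring

lemma H1 (a s : ℝ) (ha : 0 < a) (hs : 0 < s) (F : ℝ → ℝ≥0∞) (hF : Measurable F) :
    ∫⁻ u in Set.Ioi (0:ℝ), ENNReal.ofReal (u ^ (a - 1)) * F ((s ^ 2)⁻¹ * u)
      = ENNReal.ofReal (s ^ (2 * a) * Real.Gamma a) * Jop a F := by
  have ma := gdens_meas a
  have hG := Real.Gamma_pos_of_pos ha
  rw [Jop, if_neg ha.ne', ← lintegral_indicator measurableSet_Ioi,
    lint_scale (s ^ 2) (by positivity) _ (Measurable.indicator (by fun_prop) measurableSet_Ioi),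
    ← lintegral_const_mul' _ _ ENNReal.ofReal_ne_top, ← lintegral_const_mul _ (by fun_prop)]
  congr 1; ext t
  by_cases ht : 0 < t
  · rw [Set.indicator_of_mem (by simp only [Set.mem_Ioi]; positivity), gdens, if_pos ht,
      inv_mul_cancel_left₀ (by positivity), ← mul_assoc, ← mul_assoc,
      ← ENNReal.ofReal_mul (by positivity), ← ENNReal.ofReal_mul (by positivity)]
    congr 2
    rw [Real.mul_rpow (by positivity) ht.le, ← Real.rpow_natCast, ← Real.rpow_mul hs.le,
      show (2 * a) = ((2:ℕ):ℝ) + ((2:ℕ):ℝ) * (a - 1) by push_cast; ring, Real.rpow_add hs]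
    field_simp
  · rw [Set.indicator_of_notMem, gdens, if_neg ht]
    · simp
    · simp only [Set.mem_Ioi]
      rw [mul_pos_iff_of_pos_left (by positivity)]; exact ht

lemma H2 (a s : ℝ) (ha : 0 < a) (hs : 0 < s) (F : ℝ → ℝ≥0∞) (hF : Measurable F) :
    ∫⁻ y, ENNReal.ofReal (Real.exp (a * y)) * F ((s ^ 2)⁻¹ * Real.exp y)
      = ENNReal.ofReal (s ^ (2 * a) * Real.Gamma a) * Jop a F := by
  rw [← H1 a s ha hs F hF, ← Real.range_exp, ← Set.image_univ,
    lintegral_image_eq_lintegral_abs_deriv_mul MeasurableSet.univ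
      (fun x _ => (Real.hasDerivAt_exp x).hasDerivWithinAt) Real.exp_injective.injOn,
    Measure.restrict_univ]
  congr 1; ext y
  rw [← mul_assoc, ← ENNReal.ofReal_mul (by positivity), abs_of_pos (Real.exp_pos _),
    ← Real.exp_mul, ← Real.exp_add]
  ring_nf

/-- The multivariate generalised gamma–log gamma density with parameters
`(α₁,…,α_{k₁}; ρ₁,…,ρ_{k₂}; σ₁²,…,σ_{k₁}²; δ₁²,…,δ_{k₂}²; h)` integrates to 1 over
`(0,∞)^{k₁} × ℝ^{k₂}`, whenever the generator `h` satisfies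
`∫₀^∞ z^{A-1} h(z) dz = Γ(A)/π^A`, `A = Σ αᵢ + Σ ρⱼ`. -/
theorem stmt17 (k₁ k₂ : ℕ) (hks : 1 ≤ k₁ + k₂)
    (α σ : Fin k₁ → ℝ) (ρ δ : Fin k₂ → ℝ)
    (hα : ∀ i, 0 < α i) (hσ : ∀ i, 0 < σ i) (hρ : ∀ j, 0 < ρ j) (hδ : ∀ j, 0 < δ j)
    (A : ℝ) (hA : A = (∑ i, α i) + ∑ j, ρ j)
    (h : ℝ → ℝ≥0∞) (hh : Measurable h)
    (hnorm : ∫⁻ z in Set.Ioi (0 : ℝ), ENNReal.ofReal (z ^ (A - 1)) * h z =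
      ENNReal.ofReal (Real.Gamma A / Real.pi ^ A)) :
    ∫⁻ u : Fin k₁ → ℝ in Set.univ.pi (fun _ : Fin k₁ => Set.Ioi (0 : ℝ)),
      ∫⁻ y : Fin k₂ → ℝ,
        ENNReal.ofReal (Real.pi ^ A /
            ((∏ i, (σ i ^ (2 * α i) * Real.Gamma (α i))) *
              ∏ j, (δ j ^ (2 * ρ j) * Real.Gamma (ρ j)))) *
          ENNReal.ofReal (Real.exp (∑ j, ρ j * y j)) *
          (∏ i, ENNReal.ofReal ((u i) ^ (α i - 1))) *
          h ((∑ i, ((σ i) ^ 2)⁻¹ * u i) + ∑ j, ((δ j) ^ 2)⁻¹ * Real.exp (y j)) = 1 := by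
  have hA0 : 0 < A := by
    rw [hA]
    rcases Nat.eq_zero_or_pos k₁ with h0 | h0
    · have : Nonempty (Fin k₂) := ⟨⟨0, by omega⟩⟩
      exact add_pos_of_nonneg_of_pos (Finset.sum_nonneg fun i _ => (hα i).le)
        (Finset.sum_pos (fun j _ => hρ j) Finset.univ_nonempty)
    · have : Nonempty (Fin k₁) := ⟨⟨0, h0⟩⟩
      exact add_pos_of_pos_of_nonneg (Finset.sum_pos (fun j _ => hα j) Finset.univ_nonempty)
        (Finset.sum_nonneg fun i _ => (hρ i).le)
  have hGA := Real.Gamma_pos_of_pos hA0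
  have hpi := Real.rpow_pos_of_pos Real.pi_pos A
  have hJ : Jop A h = ENNReal.ofReal ((Real.pi ^ A)⁻¹) := by
    have e : ∀ z, gdens A z * h z = ENNReal.ofReal (Real.Gamma A)⁻¹ *
        (Set.Ioi (0:ℝ)).indicator (fun z => ENNReal.ofReal (z ^ (A - 1)) * h z) z := by
      intro z
      by_cases hz : 0 < z
      · rw [Set.indicator_of_mem (by exact hz), gdens, if_pos hz, ← mul_assoc,
          ← ENNReal.ofReal_mul (by positivity), div_eq_inv_mul]
      · rw [Set.indicator_of_notMem (by exact hz), gdens, if_neg hz]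
        simp
    rw [Jop, if_neg hA0.ne', lintegral_congr e, lintegral_const_mul' _ _ ENNReal.ofReal_ne_top,
      lintegral_indicator measurableSet_Ioi, hnorm, ← ENNReal.ofReal_mul (by positivity)]
    congr 1
    field_simp
  set C := ENNReal.ofReal (Real.pi ^ A /
            ((∏ i, (σ i ^ (2 * α i) * Real.Gamma (α i))) *
              ∏ j, (δ j ^ (2 * ρ j) * Real.Gamma (ρ j)))) with hC
  have mJ := Jop_meas (∑ j, ρ j) h hh
  have inner : ∀ u : Fin k₁ → ℝ, ∫⁻ y : Fin k₂ → ℝ,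
        C * ENNReal.ofReal (Real.exp (∑ j, ρ j * y j)) *
          (∏ i, ENNReal.ofReal ((u i) ^ (α i - 1))) *
          h ((∑ i, ((σ i) ^ 2)⁻¹ * u i) + ∑ j, ((δ j) ^ 2)⁻¹ * Real.exp (y j)) =
      (C * ∏ j, ENNReal.ofReal (δ j ^ (2 * ρ j) * Real.Gamma (ρ j))) *
        ((∏ i, ENNReal.ofReal ((u i) ^ (α i - 1))) *
          Jop (∑ j, ρ j) (fun z => h ((∑ i, ((σ i) ^ 2)⁻¹ * u i) + z))) := by
    intro u
    have := multi volume k₂ ρ (fun j => (hρ j).le)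
      (fun j y => ENNReal.ofReal (Real.exp (ρ j * y))) (fun j => by fun_prop)
      (fun j y => ((δ j) ^ 2)⁻¹ * Real.exp y) (fun j => by fun_prop)
      (fun j => ENNReal.ofReal (δ j ^ (2 * ρ j) * Real.Gamma (ρ j)))
      (fun j F hF => H2 _ _ (hρ j) (hδ j) F hF)
      (fun z => h ((∑ i, ((σ i) ^ 2)⁻¹ * u i) + z)) (by fun_prop)
    rw [mul_mul_mul_comm, ← this, volume_pi, ← lintegral_const_mul _ (by fun_prop)]
    congr 1; ext y
    rw [Real.exp_sum, ENNReal.ofReal_prod_of_nonneg (fun _ _ => (Real.exp_pos _).le)]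
    ring
  rw [lintegral_congr inner, volume_pi, Measure.restrict_pi_pi,
    lintegral_const_mul _ (by exact (by fun_prop : Measurable fun u : Fin k₁ → ℝ =>
      ∏ i, ENNReal.ofReal ((u i) ^ (α i - 1))).mul (mJ.comp
      (by fun_prop : Measurable fun u : Fin k₁ → ℝ => ∑ i, ((σ i) ^ 2)⁻¹ * u i)))]
  rw [multi (volume.restrict (Set.Ioi 0)) k₁ α (fun j => (hα j).le)
      (fun j y => ENNReal.ofReal (y ^ (α j - 1))) (fun j => by fun_prop)
      (fun j y => ((σ j) ^ 2)⁻¹ * y) (fun j => by fun_prop)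
      (fun j => ENNReal.ofReal (σ j ^ (2 * α j) * Real.Gamma (α j)))
      (fun j F hF => H1 _ _ (hα j) (hσ j) F hF) _ mJ,
    Jop_conv _ _ (Finset.sum_nonneg fun i _ => (hα i).le)
      (Finset.sum_nonneg fun i _ => (hρ i).le) h hh, ← hA, hJ, hC]
  have p1 : ∀ i, 0 < σ i ^ (2 * α i) * Real.Gamma (α i) := fun i =>
    mul_pos (Real.rpow_pos_of_pos (hσ i) _) (Real.Gamma_pos_of_pos (hα i))
  have p2 : ∀ i, 0 < δ i ^ (2 * ρ i) * Real.Gamma (ρ i) := fun i =>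
    mul_pos (Real.rpow_pos_of_pos (hδ i) _) (Real.Gamma_pos_of_pos (hρ i))
  have q1 := Finset.prod_pos (s := Finset.univ) fun i _ => p1 i
  have q2 := Finset.prod_pos (s := Finset.univ) fun i _ => p2 i
  rw [← ENNReal.ofReal_prod_of_nonneg (fun i _ => (p1 i).le),
    ← ENNReal.ofReal_prod_of_nonneg (fun i _ => (p2 i).le)]
  generalize (∏ i, σ i ^ (2 * α i) * Real.Gamma (α i)) = P at *
  generalize (∏ i, δ i ^ (2 * ρ i) * Real.Gamma (ρ i)) = Q at *
  rw [← ENNReal.ofReal_mul (by positivity), ← ENNReal.ofReal_mul (by positivity),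
    ← ENNReal.ofReal_mul (by positivity), ← ENNReal.ofReal_one]
  congr 1
  field_simp
end
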